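/- Let b₀, …, bₙ : ℝ × ℝ → Matrix (Fin r) (Fin r) ℝ, u : ℝ × ℝ → Matrix (Fin r) (Fin m) ℝ and v : ℝ × ℝ → Matrix (Fin m) (Fin r) ℝ be jointly smooth, with v(t,·) having support bounded below uniformly in t (there is a ∈ ℝ with v(t,y) = 0 for all y ≤ a and all t), and suppose that for all (t,x): ∂_t u(t,x) = Σ_{i=0}^{n} b_i(t,x)·∂_x^i u(t,x) and ∂_t v(t,x) = -Σ_{i=0}^{n} (-1)^i ∂_x^i(v·b_i)(t,x). For each t let B_t(g) = Σ_{i=0}^{n} b_i(t,·)·g^{(i)} and (T_t g)(x) = u(t,x)·∫_{-∞}^{x} v(t,y)·g(y) dy on W_r. Then there exist jointly smooth c₀, …, c_{n-1} : ℝ × ℝ → Matrix (Fin r) (Fin r) ℝ such that for every g ∈ W_r and all (t,x): ∂_t [(T_t g)(x)] = (B_t(T_t g) - T_t(B_t g))(x) - Σ_{i=0}^{n-1} c_i(t,x)·g^{(i)}(x). (This realizes the lemma ∂_{t_{l,β}} T_k^{(α,r)} = [B_l^{(β,r)}, T_k^{(α,r)}]₋ for the modification operator of the additional symmetries of the constrained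 multi-component KP hierarchy.) -/

import Mathlib

open MeasureTheory Finset

/-- A function `ℝ → A` has support bounded below. -/
def SuppBddBelowR {A : Type*} [Zero A] (f : ℝ → A) : Prop :=
  ∃ a : ℝ, ∀ x : ℝ, x ≤ a → f x = 0

/-- The integration operator applied componentwise to vector-valued functions. -/
noncomputable def IopV {p : ℕ} (f : ℝ → Fin p → ℝ) : ℝ → Fin p → ℝ :=
  fun x => ∫ y in Set.Iic x, f y

/-- The `k`-th derivative applied entrywise to matrix-valued functions. -/
noncomputable def matIter {p q : ℕ} (k : ℕ) (a : ℝ → Matrix (Fin p) (Fin q) ℝ) :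
    ℝ → Matrix (Fin p) (Fin q) ℝ :=
  fun x => Matrix.of fun i j => iteratedDeriv k (fun y => a y i j) x

/-- Entrywise time-derivative of a matrix-valued function of `t`. -/
noncomputable def matDeriv {p q : ℕ} (a : ℝ → Matrix (Fin p) (Fin q) ℝ) (t : ℝ) :
    Matrix (Fin p) (Fin q) ℝ :=
  Matrix.of fun i j => deriv (fun s => a s i j) t

/-- A time-dependent matrix-valued function is jointly smooth (entrywise `C^∞` on `ℝ × ℝ`). -/
def MatSmooth2 {p q : ℕ} (a : ℝ → ℝ → Matrix (Fin p) (Fin q) ℝ) : Prop :=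
  ∀ (i : Fin p) (j : Fin q), ContDiff ℝ (⊤ : ℕ∞) fun z : ℝ × ℝ => a z.1 z.2 i j

/-- The local differential operator `B_t(g) = Σ_{i=0}^{n} b_i(t,·)·g⁽ⁱ⁾` acting on `W_r`. -/
noncomputable def Bop {r : ℕ} (n : ℕ) (b : ℕ → ℝ → ℝ → Matrix (Fin r) (Fin r) ℝ) (t : ℝ)
    (g : ℝ → Fin r → ℝ) : ℝ → Fin r → ℝ :=
  fun x => ∑ i ∈ Finset.range (n + 1), (b i t x).mulVec (iteratedDeriv i g x)

/-- The operator `(T_t g)(x) = u(t,x)·∫_{-∞}^{x} v(t,y)·g(y) dy` acting on `W_r`. -/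
noncomputable def TTop {r m : ℕ} (u : ℝ → ℝ → Matrix (Fin r) (Fin m) ℝ)
    (v : ℝ → ℝ → Matrix (Fin m) (Fin r) ℝ) (t : ℝ) (g : ℝ → Fin r → ℝ) : ℝ → Fin r → ℝ :=
  fun x => (u t x).mulVec (IopV (fun y => (v t y).mulVec (g y)) x)

/-- A real function of `(t, x)` is jointly smooth. -/
def JointlySmooth (f : ℝ → ℝ → ℝ) : Prop :=
  ContDiff ℝ (⊤ : ℕ∞) fun z : ℝ × ℝ => f z.1 z.2

namespace JointlySmooth

variable {f h : ℝ → ℝ → ℝ}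

theorem zero : JointlySmooth fun _ _ => 0 := contDiff_const

theorem add (hf : JointlySmooth f) (hh : JointlySmooth h) :
    JointlySmooth fun t x => f t x + h t x :=
  ContDiff.add hf hh

theorem mul (hf : JointlySmooth f) (hh : JointlySmooth h) :
    JointlySmooth fun t x => f t x * h t x :=
  ContDiff.mul hf hh

theorem sum {ι : Type*} (s : Finset ι) {F : ι → ℝ → ℝ → ℝ} (hF : ∀ i ∈ s, JointlySmooth (F i)) :
    JointlySmooth fun t x => ∑ i ∈ s, F i t x :=
  ContDiff.sum hF

theorem right (hf : JointlySmooth f) (t : ℝ) : ContDiff ℝ (⊤ : ℕ∞) (f t) :=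
  ContDiff.comp (g := fun z : ℝ × ℝ => f z.1 z.2) hf (contDiff_prodMk_right t)

theorem left (hf : JointlySmooth f) (x : ℝ) : ContDiff ℝ (⊤ : ℕ∞) fun t => f t x :=
  ContDiff.comp (g := fun z : ℝ × ℝ => f z.1 z.2) hf (contDiff_prodMk_left x)

theorem deriv_right (hf : JointlySmooth f) : JointlySmooth fun t x => deriv (f t) x := by
  have key : ∀ z : ℝ × ℝ, deriv (f z.1) z.2 =
      fderiv ℝ (fun z : ℝ × ℝ => f z.1 z.2) z (0, 1) := fun z =>
    (HasFDerivAt.comp_hasDerivAt (f := fun y => (z.1, y)) z.2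
      (hf.differentiable (by simp) z).hasFDerivAt
      ((hasDerivAt_const z.2 z.1).prodMk (hasDerivAt_id z.2))).deriv
  unfold JointlySmooth
  simp_rw [key]
  exact (hf.fderiv_right (m := (⊤ : ℕ∞)) (by simp)).clm_apply contDiff_const

theorem deriv_left (hf : JointlySmooth f) : JointlySmooth fun t x => deriv (fun s => f s x) t :=
  (deriv_right (f := fun x t => f t x) (hf.comp (contDiff_snd.prodMk contDiff_fst))).comp
    (contDiff_snd.prodMk contDiff_fst)

theorem iteratedDeriv (hf : JointlySmooth f) (j : ℕ) :
    JointlySmooth fun t x => iteratedDeriv j (f t) x := by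
  induction j with
  | zero => simpa using hf
  | succ j ih => simpa only [iteratedDeriv_succ] using ih.deriv_right

theorem hasDerivAt_intervalIntegral (hf : JointlySmooth f) (a b t : ℝ) :
    HasDerivAt (fun s => ∫ y in a..b, f s y) (∫ y in a..b, deriv (fun s => f s y) t) t := by
  obtain ⟨C, hC⟩ := ((isCompact_Icc (a := t - 1) (b := t + 1)).prod
    (isCompact_uIcc (a := a) (b := b))).exists_bound_of_continuousOn
    (ContDiff.continuous hf.deriv_left).continuousOn
  refine (intervalIntegral.hasDerivAt_integral_of_dominated_loc_of_deriv_le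
    (F' := fun s y => deriv (fun s => f s y) s) (bound := fun _ => C)
    (Icc_mem_nhds (sub_one_lt t) (lt_add_one t))
    (Filter.Eventually.of_forall fun s => (hf.right s).continuous.aestronglyMeasurable)
    ((hf.right t).continuous.intervalIntegrable a b)
    (hf.deriv_left.right t).continuous.aestronglyMeasurable ?_
    (continuous_const.intervalIntegrable a b) ?_).2
  · exact Filter.Eventually.of_forall fun y hy s hs => hC (s, y) ⟨hs, Set.uIoc_subset_uIcc hy⟩
  · exact Filter.Eventually.of_forall fun y _ s _ =>
      ((hf.left y).differentiable (by simp) s).hasDerivAt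

end JointlySmooth

theorem ContDiff.deriv_iterated {g : ℝ → ℝ} (hg : ContDiff ℝ (⊤ : ℕ∞) g) (j : ℕ) :
    ContDiff ℝ (⊤ : ℕ∞) (iteratedDeriv j g) := by
  rw [iteratedDeriv_eq_iterate]
  exact hg.iterate_deriv j

theorem ContDiff.hasDerivAt_iteratedDeriv {g : ℝ → ℝ} (hg : ContDiff ℝ (⊤ : ℕ∞) g) (j : ℕ)
    (x : ℝ) : HasDerivAt (iteratedDeriv j g) (iteratedDeriv (j + 1) g x) x := by
  rw [iteratedDeriv_succ]
  exact ((hg.deriv_iterated j).differentiable (by simp) x).hasDerivAt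

theorem iteratedDeriv_pi {ι : Type*} [Fintype ι] {g : ℝ → ι → ℝ}
    (hg : ContDiff ℝ (⊤ : ℕ∞) g) (j : ℕ) :
    iteratedDeriv j g = fun x k => iteratedDeriv j (fun y => g y k) x := by
  induction j with
  | zero => simp
  | succ j ih =>
    ext1 x
    rw [iteratedDeriv_succ, ih, deriv_pi]
    · simp only [iteratedDeriv_succ]
    · exact fun k => ((contDiff_pi.1 hg k).deriv_iterated j).differentiable (by simp) x

/-- `L` acts on smooth functions as a linear differential operator in `x` of order less than `N`
with jointly smooth coefficients. -/
def IsDiffOp {r : ℕ} (N : ℕ) (L : (ℝ → Fin r → ℝ) → ℝ → ℝ → ℝ) : Prop :=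
  ∃ c : ℕ → Fin r → ℝ → ℝ → ℝ, (∀ j k, JointlySmooth (c j k)) ∧
    ∀ g : ℝ → Fin r → ℝ, ContDiff ℝ (⊤ : ℕ∞) g → ∀ t x,
      L g t x = ∑ j ∈ range N, ∑ k, c j k t x * iteratedDeriv j (fun y => g y k) x

namespace IsDiffOp

variable {r N : ℕ} {L L' : (ℝ → Fin r → ℝ) → ℝ → ℝ → ℝ}

theorem congr (hL : IsDiffOp N L)
    (h : ∀ g : ℝ → Fin r → ℝ, ContDiff ℝ (⊤ : ℕ∞) g → ∀ t x, L' g t x = L g t x) :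
    IsDiffOp N L' := by
  obtain ⟨c, hc, hL⟩ := hL
  exact ⟨c, hc, fun g hg t x => (h g hg t x).trans (hL g hg t x)⟩

theorem zero : IsDiffOp N fun (_ : ℝ → Fin r → ℝ) _ _ => 0 :=
  ⟨fun _ _ _ _ => 0, fun _ _ => JointlySmooth.zero, by simp⟩

theorem add (hL : IsDiffOp N L) (hL' : IsDiffOp N L') :
    IsDiffOp N fun g t x => L g t x + L' g t x := by
  obtain ⟨c, hc, hL⟩ := hL
  obtain ⟨c', hc', hL'⟩ := hL'
  refine ⟨fun j k t x => c j k t x + c' j k t x, fun j k => (hc j k).add (hc' j k), ?_⟩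
  intro g hg t x
  simp only [hL g hg, hL' g hg, add_mul, sum_add_distrib]

theorem mul {f : ℝ → ℝ → ℝ} (hf : JointlySmooth f) (hL : IsDiffOp N L) :
    IsDiffOp N fun g t x => f t x * L g t x := by
  obtain ⟨c, hc, hL⟩ := hL
  refine ⟨fun j k t x => f t x * c j k t x, fun j k => hf.mul (hc j k), ?_⟩
  intro g hg t x
  simp only [hL g hg, mul_assoc, mul_sum]

theorem neg (hL : IsDiffOp N L) : IsDiffOp N fun g t x => -L g t x :=
  (mul (f := fun _ _ => -1) (contDiff_const (c := (-1 : ℝ))) hL).congr (by simp)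

theorem sub (hL : IsDiffOp N L) (hL' : IsDiffOp N L') :
    IsDiffOp N fun g t x => L g t x - L' g t x :=
  (hL.add hL'.neg).congr fun _ _ _ _ => sub_eq_add_neg _ _

theorem sum {ι : Type*} (s : Finset ι) {L : ι → (ℝ → Fin r → ℝ) → ℝ → ℝ → ℝ}
    (hL : ∀ i ∈ s, IsDiffOp N (L i)) : IsDiffOp N fun g t x => ∑ i ∈ s, L i g t x := by
  classical
  induction s using Finset.induction_on with
  | empty => simpa using zero
  | insert i s hi ih =>
    simp only [sum_insert hi]
    exact (hL i (mem_insert_self i s)).add (ih fun j hj => hL j (mem_insert_of_mem hj))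

theorem monomial {f : ℝ → ℝ → ℝ} (hf : JointlySmooth f) {j : ℕ} (hj : j < N) (k : Fin r) :
    IsDiffOp N fun g t x => f t x * iteratedDeriv j (fun y => g y k) x := by
  refine ⟨fun j' k' t x => if j' = j then if k' = k then f t x else 0 else 0, ?_, ?_⟩
  · intro j' k'
    dsimp only
    split_ifs
    exacts [hf, JointlySmooth.zero, JointlySmooth.zero]
  · intro g _ t x
    rw [sum_eq_single_of_mem j (mem_range.2 hj), sum_eq_single_of_mem k (mem_univ k)]
    · simp
    · intro k' _ hk'
      simp [hk']
    · intro j' _ hj'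
      simp [hj']

theorem mono {M : ℕ} (hNM : N ≤ M) (hL : IsDiffOp N L) : IsDiffOp M L := by
  obtain ⟨c, hc, hL⟩ := hL
  exact congr (sum (range N) fun j hj => sum univ fun k _ =>
    monomial (hc j k) ((mem_range.1 hj).trans_le hNM) k) hL

theorem differentiable (hL : IsDiffOp N L) {g : ℝ → Fin r → ℝ} (hg : ContDiff ℝ (⊤ : ℕ∞) g)
    (t : ℝ) : Differentiable ℝ (L g t) := by
  obtain ⟨c, hc, hL⟩ := hL
  rw [funext (hL g hg t)]
  exact Differentiable.fun_sum fun j _ => Differentiable.fun_sum fun k _ =>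
    (((hc j k).right t).differentiable (by simp)).mul
      (((contDiff_pi.1 hg k).deriv_iterated j).differentiable (by simp))

theorem deriv (hL : IsDiffOp N L) : IsDiffOp (N + 1) fun g t x => deriv (L g t) x := by
  obtain ⟨c, hc, hL⟩ := hL
  refine congr (sum (range N) fun j hj => sum univ fun k _ =>
    (monomial (hc j k).deriv_right ((mem_range.1 hj).trans N.lt_succ_self) k).add
      (monomial (hc j k) (Nat.succ_lt_succ (mem_range.1 hj)) k)) ?_
  intro g hg t x
  rw [funext (hL g hg t)]
  exact (HasDerivAt.fun_sum fun j _ => HasDerivAt.fun_sum fun k _ =>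
    (((hc j k).right t).differentiable (by simp) x).hasDerivAt.mul
      ((contDiff_pi.1 hg k).hasDerivAt_iteratedDeriv j x)).deriv

/-- Leibniz rule: all but the leading term of `(u F)⁽ⁱ⁾` only involve derivatives of `F`. -/
theorem iteratedDeriv_mul_sub {u : ℝ → ℝ → ℝ} (hu : JointlySmooth u)
    {F W : (ℝ → Fin r → ℝ) → ℝ → ℝ → ℝ} (hW : IsDiffOp 1 W)
    (hF : ∀ g : ℝ → Fin r → ℝ, ContDiff ℝ (⊤ : ℕ∞) g → ∀ t x, HasDerivAt (F g t) (W g t x) x)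
    (i : ℕ) :
    IsDiffOp i fun g t x =>
      iteratedDeriv i (fun y => u t y * F g t y) x - iteratedDeriv i (u t) x * F g t x := by
  induction i with
  | zero => exact zero.congr (by simp)
  | succ i ih =>
    refine (ih.deriv.add ((hW.mono (Nat.le_add_left 1 i)).mul (hu.iteratedDeriv i))).congr ?_
    intro g hg t x
    have h1 := (ih.differentiable hg t x).hasDerivAt
    have h2 := ((hu.right t).hasDerivAt_iteratedDeriv i x).mul (hF g hg t x)
    have h3 := (h1.add h2).deriv
    rw [iteratedDeriv_succ]
    have h4 : iteratedDeriv i (fun y => u t y * F g t y) =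
        (fun y => iteratedDeriv i (fun y => u t y * F g t y) y - iteratedDeriv i (u t) y * F g t y)
          + iteratedDeriv i (u t) * F g t := by
      ext y; simp
    conv_lhs => rw [h4, h3]
    ring

/-- Repeated integration by parts. -/
theorem integral_mul_iteratedDeriv_sub {a c : ℝ} (hca : c < a) (i : ℕ) (k : Fin r)
    {p : ℝ → ℝ → ℝ} (hp : JointlySmooth p) (hpa : ∀ t y, y < a → p t y = 0) :
    IsDiffOp i fun g t x =>
      (∫ y in c..x, p t y * iteratedDeriv i (fun y => g y k) y) -
        (-1) ^ i * ∫ y in c..x, iteratedDeriv i (p t) y * g y k := by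
  induction i generalizing p with
  | zero => exact zero.congr (by simp)
  | succ i ih =>
    have hpa' : ∀ t y, y < a → _root_.deriv (p t) y = 0 := fun t y hy => by
      have h : p t =ᶠ[nhds y] fun _ => 0 := (eventually_lt_nhds hy).mono (hpa t)
      rw [h.deriv_eq, deriv_const]
    refine ((monomial hp (Nat.lt_succ_self i) k).sub
      ((ih hp.deriv_right hpa').mono (Nat.le_succ i))).congr ?_
    intro g hg t x
    rw [intervalIntegral.integral_mul_deriv_eq_deriv_mul
      (fun y _ => ((hp.right t).differentiable (by simp) y).hasDerivAt)
      (fun y _ => (contDiff_pi.1 hg k).hasDerivAt_iteratedDeriv i y)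
      ((hp.deriv_right.right t).continuous.intervalIntegrable c x)
      (((contDiff_pi.1 hg k).deriv_iterated (i + 1)).continuous.intervalIntegrable c x),
      hpa t c hca, iteratedDeriv_succ']
    ring

end IsDiffOp

section PseudoDiff

variable {r : ℕ} {v : Fin r → ℝ → ℝ → ℝ} {a c : ℝ}

theorem hasDerivAt_integral_pairing (hv : ∀ k, JointlySmooth (v k)) {g : ℝ → Fin r → ℝ}
    (hg : ContDiff ℝ (⊤ : ℕ∞) g) (c t x : ℝ) :
    HasDerivAt (fun x => ∫ y in c..x, ∑ k, v k t y * g y k) (∑ k, v k t x * g x k) x := by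
  have hcont : Continuous fun y => ∑ k, v k t y * g y k :=
    continuous_finsetSum _ fun k _ =>
      ((hv k).right t).continuous.mul (contDiff_pi.1 hg k).continuous
  exact intervalIntegral.integral_hasDerivAt_right (hcont.intervalIntegrable c x)
    (hcont.stronglyMeasurableAtFilter _ _) hcont.continuousAt

theorem hasDerivAt_integral_pairing_left (hv : ∀ k, JointlySmooth (v k)) {g : ℝ → Fin r → ℝ}
    (hg : ContDiff ℝ (⊤ : ℕ∞) g) (c t x : ℝ) :
    HasDerivAt (fun s => ∫ y in c..x, ∑ k, v k s y * g y k)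
      (∫ y in c..x, ∑ k, deriv (fun s => v k s y) t * g y k) t := by
  have hsm : JointlySmooth fun s y => ∑ k, v k s y * g y k := JointlySmooth.sum _ fun k _ =>
    (hv k).mul (ContDiff.comp (contDiff_pi.1 hg k) contDiff_snd)
  convert hsm.hasDerivAt_intervalIntegral c x t using 4 with y
  exact (HasDerivAt.fun_sum fun k _ =>
    (((hv k).left y).differentiable (by simp) t).hasDerivAt.mul_const _).deriv.symm

/-- If `v` evolves by the formal adjoint of `B`, then `∫ v (B g)` and `-∂ₜ ∫ v g` differ by a
differential operator applied to `g`. -/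
theorem IsDiffOp.integral_add_deriv {n : ℕ} {b : ℕ → Fin r → Fin r → ℝ → ℝ → ℝ} (hca : c < a)
    (hv : ∀ k, JointlySmooth (v k)) (hva : ∀ k t y, y < a → v k t y = 0)
    (hb : ∀ j l k, JointlySmooth (b j l k))
    (hveq : ∀ k t y, _root_.deriv (fun s => v k s y) t = -∑ j ∈ range (n + 1),
      (-1) ^ j * iteratedDeriv j (fun y => ∑ l, v l t y * b j l k t y) y) :
    IsDiffOp n fun g t x =>
      (∫ y in c..x, ∑ l, v l t y *
        ∑ j ∈ range (n + 1), ∑ k, b j l k t y * iteratedDeriv j (fun y => g y k) y) +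
      _root_.deriv (fun s => ∫ y in c..x, ∑ k, v k s y * g y k) t := by
  have hp : ∀ j k, JointlySmooth fun t y => ∑ l, v l t y * b j l k t y := fun j k =>
    JointlySmooth.sum _ fun l _ => (hv l).mul (hb j l k)
  refine (IsDiffOp.sum (range (n + 1)) fun j hj => IsDiffOp.sum univ fun k _ =>
    (IsDiffOp.integral_mul_iteratedDeriv_sub hca j k (hp j k) fun t y hy => by
      simp [hva _ t y hy]).mono (Nat.lt_succ_iff.1 (mem_range.1 hj))).congr ?_
  intro g hg t x
  have hgk : ∀ j k, Continuous (iteratedDeriv j fun y => g y k) := fun j k =>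
    ((contDiff_pi.1 hg k).deriv_iterated j).continuous
  have hg0 : ∀ k, Continuous fun y => g y k := fun k => (contDiff_pi.1 hg k).continuous
  have hpc : ∀ j k, Continuous fun y => ∑ l, v l t y * b j l k t y := fun j k =>
    ((hp j k).right t).continuous
  have hpc' : ∀ j k, Continuous (iteratedDeriv j fun y => ∑ l, v l t y * b j l k t y) :=
    fun j k => (((hp j k).right t).deriv_iterated j).continuous
  rw [(hasDerivAt_integral_pairing_left hv hg c t x).deriv]
  have e1 : ∀ y, ∑ l, v l t y *
      ∑ j ∈ range (n + 1), ∑ k, b j l k t y * iteratedDeriv j (fun y => g y k) y =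
      ∑ j ∈ range (n + 1), ∑ k, (∑ l, v l t y * b j l k t y) *
        iteratedDeriv j (fun y => g y k) y := fun y => by
    simp only [mul_sum, sum_mul, ← mul_assoc]
    rw [sum_comm]
    exact sum_congr rfl fun j _ => sum_comm
  have e2 : ∀ y, ∑ k, _root_.deriv (fun s => v k s y) t * g y k =
      ∑ j ∈ range (n + 1), ∑ k, -((-1) ^ j *
        (iteratedDeriv j (fun y => ∑ l, v l t y * b j l k t y) y * g y k)) := fun y => by
    simp only [hveq, neg_mul, sum_mul, ← mul_assoc, sum_neg_distrib]
    rw [sum_comm]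
  simp only [e1, e2]
  have i1 : ∀ j k, IntervalIntegrable (fun y => (∑ l, v l t y * b j l k t y) *
        iteratedDeriv j (fun y => g y k) y) volume c x := fun j k =>
    ((hpc j k).mul (hgk j k)).intervalIntegrable c x
  have i2 : ∀ j k, IntervalIntegrable (fun y => -((-1) ^ j *
        (iteratedDeriv j (fun y => ∑ l, v l t y * b j l k t y) y * g y k))) volume c x :=
    fun j k => (continuous_const.mul ((hpc' j k).mul (hg0 k))).neg.intervalIntegrable c x
  have swap : ∀ f : ℕ → Fin r → ℝ → ℝ, (∀ j k, IntervalIntegrable (f j k) volume c x) →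
      ∫ y in c..x, ∑ j ∈ range (n + 1), ∑ k, f j k y =
        ∑ j ∈ range (n + 1), ∑ k, ∫ y in c..x, f j k y := fun f hf => by
    rw [intervalIntegral.integral_finsetSum fun j _ => by
      simpa only [sum_fn] using IntervalIntegrable.sum univ fun k _ => hf j k]
    exact sum_congr rfl fun j _ => intervalIntegral.integral_finsetSum fun k _ => hf j k
  rw [swap _ i1, swap _ i2, ← sum_add_distrib]
  refine sum_congr rfl fun j _ => ?_
  rw [← sum_add_distrib]
  refine sum_congr rfl fun k _ => ?_
  rw [intervalIntegral.integral_neg, intervalIntegral.integral_const_mul, sub_eq_add_neg]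

/-- All but the leading term of `B (u F)`, where `F = ∫ v g`, is a differential operator in `g`. -/
theorem IsDiffOp.leibniz {n : ℕ} {b : ℕ → Fin r → ℝ → ℝ → ℝ} {u : Fin r → ℝ → ℝ → ℝ} (c : ℝ)
    (hv : ∀ k, JointlySmooth (v k)) (hb : ∀ j l, JointlySmooth (b j l))
    (hu : ∀ l, JointlySmooth (u l)) :
    IsDiffOp n fun g t x =>
      ∑ j ∈ range (n + 1), ∑ l, b j l t x *
        (iteratedDeriv j (fun x => u l t x * ∫ y in c..x, ∑ k, v k t y * g y k) x -
          iteratedDeriv j (u l t) x * ∫ y in c..x, ∑ k, v k t y * g y k) := by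
  have hW : IsDiffOp 1 fun (g : ℝ → Fin r → ℝ) t x => ∑ k, v k t x * g x k :=
    (IsDiffOp.sum univ fun k _ => IsDiffOp.monomial (hv k) zero_lt_one k).congr (by simp)
  exact IsDiffOp.sum _ fun j hj => IsDiffOp.sum _ fun l _ => IsDiffOp.mul (hb j l)
    ((IsDiffOp.iteratedDeriv_mul_sub (hu l) hW
      (fun g hg t x => hasDerivAt_integral_pairing hv hg c t x) j).mono
      (Nat.lt_succ_iff.1 (mem_range.1 hj)))

end PseudoDiff

theorem integrableOn_Iic_of_continuous {f : ℝ → ℝ} (hf : Continuous f) {a : ℝ}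
    (ha : ∀ y ≤ a, f y = 0) (x : ℝ) : IntegrableOn f (Set.Iic x) := by
  have h : IntegrableOn f (Set.Iic a ∪ Set.Icc a x) :=
    (integrableOn_zero.congr_fun (fun y hy => (ha y hy).symm) measurableSet_Iic).union
      hf.continuousOn.integrableOn_Icc
  refine h.mono_set fun y hy => ?_
  rcases le_total y a with h' | h'
  exacts [Or.inl h', Or.inr ⟨h', hy⟩]

theorem IopV_apply {p : ℕ} {f : ℝ → Fin p → ℝ} (hf : ∀ k, Continuous fun y => f y k) {c : ℝ}
    (hc : ∀ y ≤ c, f y = 0) (x : ℝ) (k : Fin p) : IopV f x k = ∫ y in c..x, f y k := by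
  have hck : ∀ k, ∀ y ≤ c, f y k = 0 := fun k y hy => by simp [hc y hy]
  have hfi := fun k => integrableOn_Iic_of_continuous (hf k) (hck k)
  rw [IopV, eval_integral fun k => hfi k x,
    ← intervalIntegral.integral_Iic_sub_Iic (hfi k c) (hfi k x),
    setIntegral_eq_zero_of_forall_eq_zero (t := Set.Iic c) (hck k), sub_zero]

section Operators

variable {r m : ℕ} {u : ℝ → ℝ → Matrix (Fin r) (Fin m) ℝ} {v : ℝ → ℝ → Matrix (Fin m) (Fin r) ℝ}
  {c : ℝ}

theorem MatSmooth2.entry {p q : ℕ} {w : ℝ → ℝ → Matrix (Fin p) (Fin q) ℝ} (hw : MatSmooth2 w)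
    (i : Fin p) (j : Fin q) : JointlySmooth fun t x => w t x i j :=
  hw i j

theorem TTop_apply (hv : MatSmooth2 v) (hc : ∀ t y, y ≤ c → v t y = 0) {g : ℝ → Fin r → ℝ}
    (hg : ContDiff ℝ (⊤ : ℕ∞) g) (t x : ℝ) (i : Fin r) :
    TTop u v t g x i = ∑ α, u t x i α * ∫ y in c..x, ∑ k, v t y α k * g y k := by
  simp only [TTop, Matrix.mulVec, dotProduct]
  refine sum_congr rfl fun α _ => congrArg _ (IopV_apply (fun β => ?_) (fun y hy => ?_) x α)
  · exact continuous_finsetSum univ fun k _ =>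
      ((hv.entry β k).right t).continuous.mul (contDiff_pi.1 hg k).continuous
  · rw [hc t y hy, Matrix.zero_mulVec]

theorem contDiff_integral_pairing (hv : MatSmooth2 v) {g : ℝ → Fin r → ℝ}
    (hg : ContDiff ℝ (⊤ : ℕ∞) g) (c t : ℝ) (α : Fin m) :
    ContDiff ℝ (⊤ : ℕ∞) fun x => ∫ y in c..x, ∑ k, v t y α k * g y k := by
  have hF := hasDerivAt_integral_pairing (v := fun k t y => v t y α k) (hv α) hg c t
  rw [contDiff_infty_iff_deriv]
  refine ⟨fun x => (hF x).differentiableAt, ?_⟩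
  rw [funext fun x => (hF x).deriv]
  exact ContDiff.sum fun k _ => ((hv.entry α k).right t).mul (contDiff_pi.1 hg k)

theorem contDiff_TTop (hu : MatSmooth2 u) (hv : MatSmooth2 v) (hc : ∀ t y, y ≤ c → v t y = 0)
    {g : ℝ → Fin r → ℝ} (hg : ContDiff ℝ (⊤ : ℕ∞) g) (t : ℝ) :
    ContDiff ℝ (⊤ : ℕ∞) (TTop u v t g) := by
  refine contDiff_pi.2 fun i => ?_
  simp only [TTop_apply hv hc hg]
  exact ContDiff.sum fun α _ =>
    ((hu.entry i α).right t).mul (contDiff_integral_pairing hv hg c t α)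

theorem Bop_apply (n : ℕ) (b : ℕ → ℝ → ℝ → Matrix (Fin r) (Fin r) ℝ) {g : ℝ → Fin r → ℝ}
    (hg : ContDiff ℝ (⊤ : ℕ∞) g) (t x : ℝ) (i : Fin r) :
    Bop n b t g x i =
      ∑ j ∈ range (n + 1), ∑ k, b j t x i k * iteratedDeriv j (fun y => g y k) x := by
  simp only [Bop, Finset.sum_apply, Matrix.mulVec, dotProduct, iteratedDeriv_pi hg]

theorem contDiff_Bop {n : ℕ} {b : ℕ → ℝ → ℝ → Matrix (Fin r) (Fin r) ℝ}
    (hb : ∀ i, MatSmooth2 (b i)) {g : ℝ → Fin r → ℝ} (hg : ContDiff ℝ (⊤ : ℕ∞) g) (t : ℝ) :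
    ContDiff ℝ (⊤ : ℕ∞) (Bop n b t g) := by
  refine contDiff_pi.2 fun i => ?_
  simp only [Bop_apply n b hg]
  exact ContDiff.sum fun j _ => ContDiff.sum fun k _ =>
    (((hb j).entry i k).right t).mul ((contDiff_pi.1 hg k).deriv_iterated j)

theorem hasDerivAt_TTop_left (hu : MatSmooth2 u) (hv : MatSmooth2 v)
    (hc : ∀ t y, y ≤ c → v t y = 0) {g : ℝ → Fin r → ℝ} (hg : ContDiff ℝ (⊤ : ℕ∞) g) (t x : ℝ)
    (i : Fin r) :
    HasDerivAt (fun s => TTop u v s g x i)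
      (∑ α, (deriv (fun s => u s x i α) t * (∫ y in c..x, ∑ k, v t y α k * g y k) +
        u t x i α * deriv (fun s => ∫ y in c..x, ∑ k, v s y α k * g y k) t)) t := by
  simp only [TTop_apply hv hc hg]
  exact HasDerivAt.fun_sum fun α _ =>
    (((hu.entry i α).left x).differentiable (by simp) t).hasDerivAt.mul
      (hasDerivAt_integral_pairing_left (v := fun k t y => v t y α k) (hv α) hg c t
        x).differentiableAt.hasDerivAt

theorem isDiffOp_commutator_sub_deriv {n : ℕ} {b : ℕ → ℝ → ℝ → Matrix (Fin r) (Fin r) ℝ} {a : ℝ}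
    (hb : ∀ i, MatSmooth2 (b i)) (hu : MatSmooth2 u) (hv : MatSmooth2 v)
    (hva : ∀ t y, y ≤ a → v t y = 0)
    (hueq : ∀ t x, matDeriv (fun s => u s x) t =
      ∑ i ∈ range (n + 1), b i t x * matIter i (u t) x)
    (hveq : ∀ t x, matDeriv (fun s => v s x) t =
      -∑ i ∈ range (n + 1), ((-1 : ℝ) ^ i) • matIter i (fun y => v t y * b i t y) x)
    (i : Fin r) :
    IsDiffOp n fun g t x =>
      Bop n b t (TTop u v t g) x i - TTop u v t (Bop n b t g) x i -
        deriv (fun s => TTop u v s g x i) t := by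
  have hca : a - 1 < a := sub_one_lt a
  have hc : ∀ t y, y ≤ a - 1 → v t y = 0 := fun t y hy => hva t y (hy.trans hca.le)
  have hu' : ∀ t x α, deriv (fun s => u s x i α) t =
      ∑ j ∈ range (n + 1), ∑ l, b j t x i l * iteratedDeriv j (fun y => u t y l α) x :=
    fun t x α => by
      simpa [matDeriv, matIter, Matrix.sum_apply, Matrix.mul_apply] using
        congrFun (congrFun (hueq t x) i) α
  have hv' : ∀ α k t y, deriv (fun s => v s y α k) t = -∑ j ∈ range (n + 1),
      (-1) ^ j * iteratedDeriv j (fun y => ∑ l, v t y α l * b j t y l k) y := fun α k t y => by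
    simpa [matDeriv, matIter, Matrix.sum_apply, Matrix.mul_apply] using
      congrFun (congrFun (hveq t y) α) k
  refine (IsDiffOp.sum univ fun α _ =>
    (IsDiffOp.leibniz (n := n) (v := fun k t y => v t y α k) (b := fun j l t x => b j t x i l)
      (u := fun l t x => u t x l α) (a - 1) (hv α) (fun j => hb j i) (fun l => hu l α)).sub
    (IsDiffOp.mul (hu.entry i α) (IsDiffOp.integral_add_deriv (n := n) (v := fun k t y => v t y α k)
      (b := fun j l k t y => b j t y l k) hca (hv α)
      (fun k t y hy => by simp [hva t y hy.le]) hb (hv' α)))).congr ?_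
  intro g hg t x
  rw [Bop_apply n b (contDiff_TTop hu hv hc hg t), TTop_apply hv hc (contDiff_Bop hb hg t),
    (hasDerivAt_TTop_left hu hv hc hg t x i).deriv]
  have hsum : ∀ j l, iteratedDeriv j (fun y => TTop u v t g y l) x = ∑ α, iteratedDeriv j
      (fun x => u t x l α * ∫ y in (a - 1)..x, ∑ k, v t y α k * g y k) x := fun j l => by
    simp only [TTop_apply hv hc hg]
    exact iteratedDeriv_fun_sum fun α _ => ((((hu.entry l α).right t).mul
      (contDiff_integral_pairing hv hg (a - 1) t α)).of_le (by exact_mod_cast le_top)).contDiffAt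
  simp only [hsum, hu', Bop_apply n b hg, mul_sum, mul_sub, mul_add, sum_sub_distrib,
    sum_add_distrib, sum_mul, mul_assoc]
  have hswap : ∀ f : ℕ → Fin r → Fin m → ℝ, ∑ j ∈ range (n + 1), ∑ l, ∑ α, f j l α =
      ∑ α, ∑ j ∈ range (n + 1), ∑ l, f j l α := fun f =>
    (sum_congr rfl fun j _ => sum_comm).trans sum_comm
  rw [hswap]
  ring

end Operators

/-- if `u` and `v` evolve by `∂_t u = Σ b_i·∂_x^i u` and
`∂_t v = -Σ (-1)ⁱ∂_x^i(v·b_i)`, then there exist jointly smooth `c₀,…,c_{n-1}` with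
`∂_t[(T_t g)(x)] = (B_t(T_t g) - T_t(B_t g))(x) - Σ_{i=0}^{n-1} c_i(t,x)·g⁽ⁱ⁾(x)`
for every `g ∈ W_r`. -/
theorem stmt18 {r m n : ℕ} (b : ℕ → ℝ → ℝ → Matrix (Fin r) (Fin r) ℝ)
    (u : ℝ → ℝ → Matrix (Fin r) (Fin m) ℝ) (v : ℝ → ℝ → Matrix (Fin m) (Fin r) ℝ)
    (hb : ∀ i, MatSmooth2 (b i)) (hu : MatSmooth2 u) (hv : MatSmooth2 v)
    (hvsupp : ∃ a : ℝ, ∀ (t y : ℝ), y ≤ a → v t y = 0)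
    (hueq : ∀ (t x : ℝ),
      matDeriv (fun s => u s x) t
        = ∑ i ∈ Finset.range (n + 1), b i t x * matIter i (u t) x)
    (hveq : ∀ (t x : ℝ),
      matDeriv (fun s => v s x) t
        = -∑ i ∈ Finset.range (n + 1),
            ((-1 : ℝ) ^ i) • matIter i (fun y => v t y * b i t y) x) :
    ∃ c : ℕ → ℝ → ℝ → Matrix (Fin r) (Fin r) ℝ,
      (∀ i, MatSmooth2 (c i)) ∧
      ∀ g : ℝ → Fin r → ℝ, ContDiff ℝ (⊤ : ℕ∞) g → SuppBddBelowR g →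
        ∀ (t x : ℝ) (i : Fin r),
          deriv (fun s => TTop u v s g x i) t
            = (Bop n b t (TTop u v t g) x - TTop u v t (Bop n b t g) x
                - ∑ j ∈ Finset.range n, (c j t x).mulVec (iteratedDeriv j g x)) i := by
  obtain ⟨a, hva⟩ := hvsupp
  choose C hC hCeq using isDiffOp_commutator_sub_deriv hb hu hv hva hueq hveq
  refine ⟨fun j t x => Matrix.of fun i k => C i j k t x, fun j i k => hC i j k, ?_⟩
  intro g hg _ t x i
  simp only [Pi.sub_apply, Finset.sum_apply, Matrix.mulVec, dotProduct, Matrix.of_apply,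
    iteratedDeriv_pi hg]
  rw [← hCeq i g hg t x]
  ring
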